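/- arXiv:2408.03976 — 2 statements merged into one kernel-verified Lean document; each statement's English description precedes it below -/
import Mathlib

section
/- Let n ≥ 3 and let k be an integer with 1 ≤ k ≤ ⌊n/2⌋ (i.e. k at most the diameter of the cycle C_n). Then the k-distance mutual-visibility number of the cycle C_n equals 3 if n ≤ 3k, and equals 2 if n ≥ 3k+1. -/
open SimpleGraph

/-- Two vertices `x, y` are `S_k`-visible in `G`: there is a shortest `x,y`-path of length
at most `k` none of whose internal vertices lies in `S`. -/
def SKVisible {V : Type*} (G : SimpleGraph V) (S : Set V) (k : ℕ) (x y : V) : Prop :=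
  ∃ p : G.Walk x y, p.IsPath ∧ p.length = G.dist x y ∧ p.length ≤ k ∧
    ∀ v ∈ p.support, v ∈ S → v = x ∨ v = y

/-- `S` is a `k`-distance mutual-visibility set of `G`. -/
def IsKDistMutualVisSet {V : Type*} (G : SimpleGraph V) (k : ℕ) (S : Set V) : Prop :=
  ∀ ⦃x⦄, x ∈ S → ∀ ⦃y⦄, y ∈ S → SKVisible G S k x y

/-- The `k`-distance mutual-visibility number `μ_k(G)`. -/
noncomputable def kdistMu {V : Type*} (G : SimpleGraph V) (k : ℕ) : ℕ :=
  sSup {n | ∃ S : Finset V, IsKDistMutualVisSet G k ↑S ∧ S.card = n}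

/-- Two vertices `x, y` are `S`-visible in `G`. -/
def SVisible {V : Type*} (G : SimpleGraph V) (S : Set V) (x y : V) : Prop :=
  ∃ p : G.Walk x y, p.IsPath ∧ p.length = G.dist x y ∧
    ∀ v ∈ p.support, v ∈ S → v = x ∨ v = y

/-- `S` is a mutual-visibility set of `G`. -/
def IsMutualVisSet {V : Type*} (G : SimpleGraph V) (S : Set V) : Prop :=
  ∀ ⦃x⦄, x ∈ S → ∀ ⦃y⦄, y ∈ S → SVisible G S x y

/-- The mutual-visibility number `μ(G)`. -/
noncomputable def mutualVisNum {V : Type*} (G : SimpleGraph V) : ℕ :=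
  sSup {n | ∃ S : Finset V, IsMutualVisSet G ↑S ∧ S.card = n}

theorem Fin.val_sub_eq_ite {n : ℕ} (a b : Fin n) :
    (a - b).val = if b.val ≤ a.val then a.val - b.val else n + a.val - b.val := by
  split_ifs with h
  · exact Fin.sub_val_of_le h
  · rw [Fin.val_sub, Nat.mod_eq_of_lt] <;> omega

/-- A walk in a cycle covers one of the two arcs between its endpoints. -/
theorem SimpleGraph.Walk.cycleGraph_arc_subset_support {n : ℕ} {x y : Fin n}
    (p : (cycleGraph n).Walk x y) :
    ((y - x).val ≤ p.length ∧ ∀ v : Fin n, (v - x).val ≤ (y - x).val → v ∈ p.support) ∨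
    ((x - y).val ≤ p.length ∧ ∀ v : Fin n, (v - y).val ≤ (x - y).val → v ∈ p.support) := by
  simp only [Fin.val_sub_eq_ite]
  induction p with
  | nil =>
    refine Or.inl ⟨by simp, fun v hv => ?_⟩
    rw [Walk.support_nil, List.mem_singleton, Fin.ext_iff]
    split_ifs at hv <;> omega
  | @cons x z y h p ih =>
    rw [cycleGraph_adj', Fin.val_sub_eq_ite, Fin.val_sub_eq_ite] at h
    simp only [Walk.length_cons, Walk.support_cons, List.mem_cons]
    have hx := x.isLt
    have hy := y.isLt
    have hz := z.isLt
    have hzs := p.start_mem_support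
    by_cases hyx : y.val = x.val
    · refine Or.inl ⟨by split_ifs <;> omega, fun v hv => Or.inl (Fin.ext ?_)⟩
      split_ifs at hv <;> omega
    by_cases hyz : y.val = z.val
    · rcases h with h | h
      · refine Or.inr ⟨by split_ifs at h ⊢ <;> omega, fun v hv => ?_⟩
        have : v.val = x.val ∨ v.val = z.val := by split_ifs at h hv <;> omega
        exact this.imp Fin.ext fun e => (Fin.ext e : v = z) ▸ hzs
      · refine Or.inl ⟨by split_ifs at h ⊢ <;> omega, fun v hv => ?_⟩
        have : v.val = x.val ∨ v.val = z.val := by split_ifs at h hv <;> omega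
        exact this.imp Fin.ext fun e => (Fin.ext e : v = z) ▸ hzs
    refine ih.imp ?_ ?_ <;>
    · rintro ⟨h1, h2⟩
      refine ⟨by split_ifs at h h1 ⊢ <;> omega, fun v hv => ?_⟩
      by_cases hvx : v.val = x.val
      · exact Or.inl (Fin.ext hvx)
      · refine Or.inr (h2 v ?_)
        split_ifs at h hv ⊢ <;> omega

/-- Two vertices of a cycle are joined by a walk along the arc from the first to the second. -/
theorem SimpleGraph.cycleGraph_exists_walk_arc {n : ℕ} (x y : Fin n) :
    ∃ p : (cycleGraph n).Walk x y, p.length = (y - x).val ∧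
      ∀ v ∈ p.support, (v - x).val ≤ (y - x).val := by
  obtain ⟨m, hm⟩ : ∃ m, (y - x).val = m := ⟨_, rfl⟩
  simp only [Fin.val_sub_eq_ite] at hm ⊢
  induction m generalizing x with
  | zero =>
    obtain rfl : y = x := Fin.ext (by split_ifs at hm <;> omega)
    exact ⟨Walk.nil, by simp, by simp⟩
  | succ m ih =>
    have hx := x.isLt
    have hy := y.isLt
    obtain ⟨z, hz⟩ : ∃ z : Fin n, z.val = if x.val + 1 < n then x.val + 1 else 0 :=
      ⟨⟨if x.val + 1 < n then x.val + 1 else 0, by split_ifs <;> omega⟩, rfl⟩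
    have hadj : (cycleGraph n).Adj x z := by
      rw [cycleGraph_adj', Fin.val_sub_eq_ite, Fin.val_sub_eq_ite]
      right
      split_ifs at hm hz ⊢ <;> omega
    have hzy : (if z.val ≤ y.val then y.val - z.val else n + y.val - z.val) = m := by
      split_ifs at hm hz ⊢ <;> omega
    obtain ⟨p, hp, hs⟩ := ih z hzy
    refine ⟨Walk.cons hadj p, by rw [Walk.length_cons, hp, hzy, hm], fun v hv => ?_⟩
    rw [Walk.support_cons, List.mem_cons] at hv
    rcases hv with rfl | hv
    · simp
    · have := hs v hv
      rw [hzy] at this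
      rw [hm]
      split_ifs at hm hz this ⊢ <;> omega

theorem SKVisible.symm {V : Type*} {G : SimpleGraph V} {S : Set V} {k : ℕ} {x y : V}
    (h : SKVisible G S k x y) : SKVisible G S k y x := by
  obtain ⟨p, h1, h2, h3, h4⟩ := h
  exact ⟨p.reverse, h1.reverse, by rw [Walk.length_reverse, h2, dist_comm], by simpa using h3,
    fun v hv hS => (h4 v (by simpa using hv) hS).symm⟩

theorem SKVisible.refl {V : Type*} (G : SimpleGraph V) (S : Set V) (k : ℕ) (x : V) :
    SKVisible G S k x x :=
  ⟨Walk.nil, by simp, by simp, by simp, by simp⟩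

/-- If `x, y` are visible in a cycle, then one of the arcs between them is short and free of
further elements of `S`. -/
theorem SKVisible.cycleGraph_arc {n k : ℕ} {S : Set (Fin n)} {x y : Fin n}
    (h : SKVisible (cycleGraph n) S k x y) :
    ((y - x).val ≤ k ∧ ∀ v ∈ S, (v - x).val ≤ (y - x).val → v = x ∨ v = y) ∨
    ((x - y).val ≤ k ∧ ∀ v ∈ S, (v - y).val ≤ (x - y).val → v = x ∨ v = y) := by
  obtain ⟨p, -, -, hk, hS⟩ := h
  exact p.cycleGraph_arc_subset_support.imp
    (fun h => ⟨h.1.trans hk, fun v hv hle => hS v (h.2 v hle) hv⟩)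
    (fun h => ⟨h.1.trans hk, fun v hv hle => hS v (h.2 v hle) hv⟩)

theorem skVisible_cycleGraph_of_arc {n k : ℕ} (hk : k ≤ n / 2) {S : Set (Fin n)} {x y : Fin n}
    (hle : (y - x).val ≤ k) (hS : ∀ v ∈ S, (v - x).val ≤ (y - x).val → v = x ∨ v = y) :
    SKVisible (cycleGraph n) S k x y := by
  obtain ⟨p, hp, hs⟩ := cycleGraph_exists_walk_arc x y
  have hdist : p.length = (cycleGraph n).dist x y := by
    refine le_antisymm ?_ (dist_le p)
    obtain ⟨q, hq⟩ := p.reachable.exists_walk_length_eq_dist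
    rw [← hq, hp]
    rcases q.cycleGraph_arc_subset_support with h | h
    · exact h.1
    · refine le_trans ?_ h.1
      simp only [Fin.val_sub_eq_ite] at hle ⊢
      have hx := x.isLt
      have hy := y.isLt
      split_ifs at hle ⊢ <;> omega
  exact ⟨p, p.isPath_of_length_eq_dist hdist, hdist, hp ▸ hle, fun v hv hvS => hS v hvS (hs v hv)⟩

theorem IsKDistMutualVisSet.card_le_three {n k : ℕ} {S : Finset (Fin n)}
    (h : IsKDistMutualVisSet (cycleGraph n) k (S : Set (Fin n))) : S.card ≤ 3 := by
  by_contra! hc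
  let f := S.orderEmbOfCardLe (show 4 ≤ S.card from hc)
  have hf (i) : f i ∈ (S : Set (Fin n)) := S.orderEmbOfCardLe_mem hc i
  have h01 : (f 0).val < (f 1).val := f.strictMono (by decide)
  have h12 : (f 1).val < (f 2).val := f.strictMono (by decide)
  have h23 : (f 2).val < (f 3).val := f.strictMono (by decide)
  rcases (h (hf 0) (hf 2)).cycleGraph_arc with ⟨-, h'⟩ | ⟨-, h'⟩
  · have := h' _ (hf 1)
    simp only [Fin.val_sub_eq_ite, Fin.ext_iff] at this
    split_ifs at this <;> omega
  · have := h' _ (hf 3)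
    simp only [Fin.val_sub_eq_ite, Fin.ext_iff] at this
    split_ifs at this <;> omega

theorem IsKDistMutualVisSet.le_three_mul {n k : ℕ} {S : Finset (Fin n)}
    (h : IsKDistMutualVisSet (cycleGraph n) k (S : Set (Fin n))) (hc : 3 ≤ S.card) :
    n ≤ 3 * k := by
  let f := S.orderEmbOfCardLe hc
  have hf (i) : f i ∈ (S : Set (Fin n)) := S.orderEmbOfCardLe_mem hc i
  have h01 : (f 0).val < (f 1).val := f.strictMono (by decide)
  have h12 : (f 1).val < (f 2).val := f.strictMono (by decide)
  have hlt := (f 2).isLt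
  have g01 : (f 1).val - (f 0).val ≤ k := by
    have := (h (hf 0) (hf 1)).cycleGraph_arc.imp id (And.imp_right fun h' => h' _ (hf 2))
    simp only [Fin.val_sub_eq_ite, Fin.ext_iff] at this
    split_ifs at this <;> omega
  have g12 : (f 2).val - (f 1).val ≤ k := by
    have := (h (hf 1) (hf 2)).cycleGraph_arc.imp id (And.imp_right fun h' => h' _ (hf 0))
    simp only [Fin.val_sub_eq_ite, Fin.ext_iff] at this
    split_ifs at this <;> omega
  have g20 : n + (f 0).val - (f 2).val ≤ k := by
    have := (h (hf 0) (hf 2)).cycleGraph_arc.imp (And.imp_right fun h' => h' _ (hf 1)) id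
    simp only [Fin.val_sub_eq_ite, Fin.ext_iff] at this
    split_ifs at this <;> omega
  omega

theorem exists_isKDistMutualVisSet_card_eq_two {n k : ℕ} (hn : 3 ≤ n) (hk1 : 1 ≤ k)
    (hk : k ≤ n / 2) :
    ∃ S : Finset (Fin n), IsKDistMutualVisSet (cycleGraph n) k (S : Set (Fin n)) ∧
      S.card = 2 := by
  obtain ⟨x, hx⟩ : ∃ x : Fin n, x.val = 0 := ⟨⟨0, by omega⟩, rfl⟩
  obtain ⟨y, hy⟩ : ∃ y : Fin n, y.val = 1 := ⟨⟨1, by omega⟩, rfl⟩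
  have hxy : x ≠ y := fun e => by have := congrArg Fin.val e; omega
  have hv : SKVisible (cycleGraph n) (({x, y} : Finset (Fin n)) : Set (Fin n)) k x y := by
    refine skVisible_cycleGraph_of_arc hk ?_ fun v hv _ => by simpa using hv
    rw [Fin.val_sub_eq_ite]
    split_ifs <;> omega
  refine ⟨{x, y}, fun a ha b hb => ?_, Finset.card_pair hxy⟩
  rw [Finset.mem_coe, Finset.mem_insert, Finset.mem_singleton] at ha hb
  rcases ha with rfl | rfl <;> rcases hb with rfl | rfl
  exacts [.refl .., hv, hv.symm, .refl ..]

theorem exists_isKDistMutualVisSet_card_eq_three {n k : ℕ} (hn : 3 ≤ n) (hk : k ≤ n / 2)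
    (hnk : n ≤ 3 * k) :
    ∃ S : Finset (Fin n), IsKDistMutualVisSet (cycleGraph n) k (S : Set (Fin n)) ∧
      S.card = 3 := by
  obtain ⟨x, hx⟩ : ∃ x : Fin n, x.val = 0 := ⟨⟨0, by omega⟩, rfl⟩
  obtain ⟨y, hy⟩ : ∃ y : Fin n, y.val = n / 3 := ⟨⟨n / 3, by omega⟩, rfl⟩
  obtain ⟨z, hz⟩ : ∃ z : Fin n, z.val = n / 3 + (n + 1) / 3 :=
    ⟨⟨n / 3 + (n + 1) / 3, by omega⟩, rfl⟩
  have hxy : x ≠ y := fun e => by have := congrArg Fin.val e; omega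
  have hxz : x ≠ z := fun e => by have := congrArg Fin.val e; omega
  have hyz : y ≠ z := fun e => by have := congrArg Fin.val e; omega
  have hxy' : SKVisible (cycleGraph n) (({x, y, z} : Finset (Fin n)) : Set (Fin n)) k x y := by
    refine skVisible_cycleGraph_of_arc hk ?_ fun v hv hle => ?_
    · rw [Fin.val_sub_eq_ite]
      split_ifs <;> omega
    · simp only [Finset.mem_coe, Finset.mem_insert, Finset.mem_singleton, Fin.ext_iff] at hv ⊢
      simp only [Fin.val_sub_eq_ite] at hle
      split_ifs at hle <;> omega
  have hyz' : SKVisible (cycleGraph n) (({x, y, z} : Finset (Fin n)) : Set (Fin n)) k y z := by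
    refine skVisible_cycleGraph_of_arc hk ?_ fun v hv hle => ?_
    · rw [Fin.val_sub_eq_ite]
      split_ifs <;> omega
    · simp only [Finset.mem_coe, Finset.mem_insert, Finset.mem_singleton, Fin.ext_iff] at hv ⊢
      simp only [Fin.val_sub_eq_ite] at hle
      split_ifs at hle <;> omega
  have hzx' : SKVisible (cycleGraph n) (({x, y, z} : Finset (Fin n)) : Set (Fin n)) k z x := by
    refine skVisible_cycleGraph_of_arc hk ?_ fun v hv hle => ?_
    · rw [Fin.val_sub_eq_ite]
      split_ifs <;> omega
    · simp only [Finset.mem_coe, Finset.mem_insert, Finset.mem_singleton, Fin.ext_iff] at hv ⊢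
      simp only [Fin.val_sub_eq_ite] at hle
      split_ifs at hle <;> omega
  refine ⟨{x, y, z}, fun a ha b hb => ?_, Finset.card_eq_three.2 ⟨x, y, z, hxy, hxz, hyz, rfl⟩⟩
  rw [Finset.mem_coe, Finset.mem_insert, Finset.mem_insert, Finset.mem_singleton] at ha hb
  rcases ha with rfl | rfl | rfl <;> rcases hb with rfl | rfl | rfl
  exacts [.refl .., hxy', hzx'.symm, hxy'.symm, .refl .., hyz', hzx', hyz'.symm, .refl ..]

/-- For `n ≥ 3` and `1 ≤ k ≤ ⌊n/2⌋`, `μ_k(C_n) = 3` if `n ≤ 3k` and `μ_k(C_n) = 2`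
if `n ≥ 3k + 1`. -/
theorem stmt6 (n k : ℕ) (hn : 3 ≤ n) (hk1 : 1 ≤ k) (hk : k ≤ n / 2) :
    (n ≤ 3 * k → kdistMu (SimpleGraph.cycleGraph n) k = 3) ∧
    (3 * k + 1 ≤ n → kdistMu (SimpleGraph.cycleGraph n) k = 2) := by
  refine ⟨fun hnk => IsGreatest.csSup_eq ⟨?_, ?_⟩, fun hnk => IsGreatest.csSup_eq ⟨?_, ?_⟩⟩
  · exact exists_isKDistMutualVisSet_card_eq_three hn hk hnk
  · rintro _ ⟨S, hS, rfl⟩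
    exact hS.card_le_three
  · exact exists_isKDistMutualVisSet_card_eq_two hn hk1 hk
  · rintro _ ⟨S, hS, rfl⟩
    by_contra! hc
    have := hS.le_three_mul hc
    omega
end

section
/- Let T be a finite tree and let k be an integer with 2 ≤ k ≤ diam(T). Then μ_k(T) = max{ μ(T') : T' a subtree of T with diameter at most k }, where the maximum is taken over all (connected) subtrees T' of T whose diameter is at most k. -/
open SimpleGraph

namespace SimpleGraph

variable {V : Type*} {G : SimpleGraph V}

/-- In an acyclic graph every path is a shortest path. -/
lemma IsAcyclic.length_eq_dist_of_isPath (hG : G.IsAcyclic) {u v : V} {p : G.Walk u v}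
    (hp : p.IsPath) : p.length = G.dist u v := by
  obtain ⟨q, hq, hlen⟩ := p.reachable.exists_path_of_dist
  have h : p = q := congrArg Subtype.val ((hG.subsingleton_path u v).elim ⟨p, hp⟩ ⟨q, hq⟩)
  rw [h, hlen]

lemma IsAcyclic.induce_length_eq_dist_of_isPath (hG : G.IsAcyclic) {A : Set V} {u v : A}
    {p : (G.induce A).Walk u v} (hp : p.IsPath) : p.length = G.dist (u : V) v := by
  have h := hG.length_eq_dist_of_isPath
    (hp.map (f := (Embedding.induce A).toHom) Subtype.val_injective)
  rwa [Walk.length_map] at h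

/-- Connected induced subgraphs of an acyclic graph are isometric. -/
lemma IsAcyclic.induce_dist_eq (hG : G.IsAcyclic) {A : Set V} (hA : (G.induce A).Connected)
    (u v : A) : (G.induce A).dist u v = G.dist (u : V) v := by
  obtain ⟨p, hp, hlen⟩ := hA.exists_path_of_dist u v
  rw [← hlen, hG.induce_length_eq_dist_of_isPath hp]

/-- In a tree, the distance from a fixed vertex to a vertex of a path is at most the distance to
one of the ends of the path. -/
lemma IsTree.dist_le_dist_endpoint (hG : G.IsTree) {x y u : V} {p : G.Walk x y} (hp : p.IsPath)
    (hu : u ∈ p.support) (w : V) : G.dist w u ≤ G.dist w x ∨ G.dist w u ≤ G.dist w y := by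
  classical
  obtain ⟨q, -, hqlen⟩ := hG.connected.exists_path_of_dist w x
  obtain ⟨r, -, hrlen⟩ := hG.connected.exists_path_of_dist w y
  have h : p = (q.reverse.append r).bypass :=
    congrArg Subtype.val
      ((hG.isAcyclic.subsingleton_path x y).elim ⟨p, hp⟩ ⟨_, (q.reverse.append r).bypass_isPath⟩)
  rw [h] at hu
  have hu' := Walk.support_bypass_subset_support _ hu
  rw [Walk.mem_support_append_iff, Walk.support_reverse, List.mem_reverse] at hu'
  rcases hu' with hu' | hu'
  · exact .inl (hqlen ▸ (dist_le _).trans (q.length_takeUntil_le_length hu'))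
  · exact .inr (hrlen ▸ (dist_le _).trans (r.length_takeUntil_le_length hu'))

/-- The union of all paths of `G` with both ends in `S`. -/
def pathHull (G : SimpleGraph V) (S : Set V) : Set V :=
  {v | ∃ x ∈ S, ∃ y ∈ S, ∃ p : G.Walk x y, p.IsPath ∧ v ∈ p.support}

lemma subset_pathHull (S : Set V) : S ⊆ G.pathHull S :=
  fun x hx ↦ ⟨x, hx, x, hx, .nil, .nil, by simp⟩

lemma Connected.induce_pathHull (hG : G.Connected) {S : Set V} (hS : S.Nonempty) :
    (G.induce (G.pathHull S)).Connected := by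
  classical
  obtain ⟨x₀, hx₀⟩ := hS
  rw [connected_iff_exists_forall_reachable]
  refine ⟨⟨x₀, subset_pathHull S hx₀⟩, ?_⟩
  rintro ⟨v, x, hx, y, hy, p, hp, hv⟩
  obtain ⟨q, hq, -⟩ := hG.exists_path_of_dist x₀ x
  have hsub : ∀ u ∈ (q.append (p.takeUntil v hv)).support, u ∈ G.pathHull S := by
    intro u hu
    rcases Walk.mem_support_append_iff _ _ |>.1 hu with hu | hu
    · exact ⟨x₀, hx₀, x, hx, q, hq, hu⟩
    · exact ⟨x, hx, y, hy, p, hp, p.support_takeUntil_subset_support hv hu⟩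
  exact ((q.append (p.takeUntil v hv)).induce _ hsub).reachable

lemma IsTree.dist_le_of_mem_pathHull (hG : G.IsTree) {S : Set V} {k : ℕ}
    (hS : ∀ x ∈ S, ∀ y ∈ S, G.dist x y ≤ k) {u v : V} (hu : u ∈ G.pathHull S)
    (hv : v ∈ G.pathHull S) : G.dist u v ≤ k := by
  have extend {w t : V} (ht : t ∈ G.pathHull S) : ∃ z ∈ S, G.dist w t ≤ G.dist w z := by
    obtain ⟨x, hx, y, hy, p, hp, htp⟩ := ht
    rcases hG.dist_le_dist_endpoint hp htp w with h | h
    exacts [⟨x, hx, h⟩, ⟨y, hy, h⟩]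
  obtain ⟨x, hx, hux⟩ := extend (w := u) hv
  obtain ⟨y, hy, hxy⟩ := extend (w := x) hu
  rw [dist_comm] at hxy
  exact hux.trans (hxy.trans (hS x hx y hy))

end SimpleGraph

lemma IsKDistMutualVisSet.card_le_kdistMu {V : Type*} [Fintype V] {G : SimpleGraph V} {k : ℕ}
    {S : Finset V} (hS : IsKDistMutualVisSet G k (S : Set V)) : S.card ≤ kdistMu G k :=
  le_csSup ⟨Fintype.card V, by rintro _ ⟨S, -, rfl⟩; exact S.card_le_univ⟩ ⟨S, hS, rfl⟩

lemma IsMutualVisSet.card_le_mutualVisNum {V : Type*} [Finite V] {G : SimpleGraph V}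
    {S : Finset V} (hS : IsMutualVisSet G (S : Set V)) : S.card ≤ mutualVisNum G := by
  have := Fintype.ofFinite V
  exact le_csSup ⟨Fintype.card V, by rintro _ ⟨S, -, rfl⟩; exact S.card_le_univ⟩ ⟨S, hS, rfl⟩

/-- A mutual-visibility set of a subtree of diameter at most `k` is a `k`-distance
mutual-visibility set of the whole tree. -/
lemma IsMutualVisSet.image_val_isKDistMutualVisSet {V : Type*} [Finite V] {G : SimpleGraph V}
    (hG : G.IsAcyclic) {k : ℕ} {A : Set V} (hA : (G.induce A).Connected)
    (hdiam : (G.induce A).diam ≤ k) {S : Set A} (hS : IsMutualVisSet (G.induce A) S) :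
    IsKDistMutualVisSet G k (Subtype.val '' S) := by
  rintro _ ⟨x, hx, rfl⟩ _ ⟨y, hy, rfl⟩
  obtain ⟨p, hp, hlen, hvis⟩ := hS hx hy
  have hp' := hp.map (f := (Embedding.induce A).toHom) Subtype.val_injective
  have := hA.nonempty
  refine ⟨_, hp', hG.length_eq_dist_of_isPath hp', ?_, ?_⟩
  · exact (Walk.length_map _ p).trans_le <| hlen.trans_le <|
      (dist_le_diam (connected_iff_ediam_ne_top.1 hA)).trans hdiam
  · rintro v hv ⟨w, hw, rfl⟩
    obtain ⟨w', hw', hww'⟩ := List.mem_map.1 (Walk.support_map _ p ▸ hv)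
    obtain rfl : w' = w := Subtype.val_injective hww'
    exact (hvis w' hw' hw).imp (congrArg _) (congrArg _)

/-- A `k`-distance mutual-visibility set of an acyclic graph is a mutual-visibility set of the
union of the paths joining its vertices. -/
lemma IsKDistMutualVisSet.isMutualVisSet_pathHull {V : Type*} {G : SimpleGraph V}
    (hG : G.IsAcyclic) {k : ℕ} {S : Set V} (hS : IsKDistMutualVisSet G k S)
    (hconn : (G.induce (G.pathHull S)).Connected) :
    IsMutualVisSet (G.induce (G.pathHull S)) (Subtype.val ⁻¹' S) := by
  rintro x hx y hy
  obtain ⟨p, hp, hlen, -, hvis⟩ := hS hx hy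
  have hsub : ∀ v ∈ p.support, v ∈ G.pathHull S := fun v hv ↦ ⟨x, hx, y, hy, p, hp, hv⟩
  have hmap := p.map_induce hsub
  have hpath : (p.induce _ hsub).IsPath := by
    apply Walk.IsPath.of_map (f := (Embedding.induce (G.pathHull S)).toHom)
    rw [hmap]
    exact hp
  refine ⟨p.induce _ hsub, hpath, ?_, fun v hv hvS ↦ ?_⟩
  · rw [hG.induce_length_eq_dist_of_isPath hpath, hG.induce_dist_eq hconn]
  · have hv' : (v : V) ∈ p.support := by
      simpa [Walk.support_induce] using hv
    exact (hvis v hv' hvS).imp Subtype.ext Subtype.ext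

/-- For a finite tree `T` and `2 ≤ k ≤ diam(T)`,
`μ_k(T) = max { μ(T') : T' a subtree of T of diameter at most k }`, where subtrees are
(induced) connected subgraphs of `T`. -/
theorem stmt8 {V : Type*} [Fintype V] (T : SimpleGraph V) (hT : T.IsTree)
    (k : ℕ) (hk2 : 2 ≤ k) (hkd : k ≤ T.diam) :
    kdistMu T k = sSup {n | ∃ A : Set V, (T.induce A).Connected ∧
      (T.induce A).diam ≤ k ∧ mutualVisNum (T.induce A) = n} := by
  classical
  have upper : ∀ n ∈ {n | ∃ A : Set V, (T.induce A).Connected ∧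
      (T.induce A).diam ≤ k ∧ mutualVisNum (T.induce A) = n}, n ≤ kdistMu T k := by
    rintro _ ⟨A, hA, hdiam, rfl⟩
    refine csSup_le' ?_
    rintro _ ⟨S, hS, rfl⟩
    rw [← S.card_map (Function.Embedding.subtype _)]
    apply IsKDistMutualVisSet.card_le_kdistMu
    rw [Finset.coe_map]
    exact hS.image_val_isKDistMutualVisSet hT.isAcyclic hA hdiam
  refine le_antisymm (csSup_le' ?_) (csSup_le' upper)
  rintro _ ⟨S, hS, rfl⟩
  rcases S.eq_empty_or_nonempty with rfl | hne
  · simp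
  have hconn := hT.connected.induce_pathHull (S := (S : Set V)) hne
  have hdist : ∀ x ∈ (S : Set V), ∀ y ∈ (S : Set V), T.dist x y ≤ k := fun x hx y hy ↦ by
    obtain ⟨p, -, hlen, hle, -⟩ := hS hx hy
    exact hlen ▸ hle
  have hdiam : (T.induce (T.pathHull (S : Set V))).diam ≤ k := by
    have := hconn.nonempty
    obtain ⟨u, v, huv⟩ := (T.induce (T.pathHull (S : Set V))).exists_dist_eq_diam
    rw [← huv, hT.isAcyclic.induce_dist_eq hconn]
    exact hT.dist_le_of_mem_pathHull hdist u.2 v.2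
  have hvis : IsMutualVisSet (T.induce (T.pathHull (S : Set V)))
      (S.subtype (· ∈ T.pathHull (S : Set V)) : Set (T.pathHull (S : Set V))) := by
    convert hS.isMutualVisSet_pathHull hT.isAcyclic hconn
    ext v
    simp
  have hcard : (S.subtype (· ∈ T.pathHull (S : Set V))).card = S.card := by
    rw [Finset.card_subtype, Finset.filter_true_of_mem fun x hx ↦ subset_pathHull _ hx]
  exact (hcard ▸ hvis.card_le_mutualVisNum).trans
    (le_csSup ⟨_, upper⟩ ⟨_, hconn, hdiam, rfl⟩)
end
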